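/- The function ε₁(τ) = (1/16)θ₂(0,τ)⁴ θ₃(0,τ)⁴ is a modular form of weight 4 over Γ₀(2) with trivial character: it is holomorphic on the upper half-plane ℍ, satisfies ε₁((aτ+b)/(cτ+d)) = (cτ+d)⁴ ε₁(τ) for every matrix (a b; c d) ∈ Γ₀(2) and τ ∈ ℍ, and for every γ ∈ SL₂(ℤ) the weight-4 slash translate of ε₁ by γ is bounded as Im τ → ∞. -/

import Mathlib

open Complex

noncomputable section

/-- `q^s = e^{2πisτ}`. -/
def qpow (s τ : ℂ) : ℂ := Complex.exp (2 * (Real.pi : ℂ) * Complex.I * s * τ)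

/-- The Jacobi theta function `θ(v, τ)`, defined by its infinite product. -/
def jTheta (v τ : ℂ) : ℂ :=
  2 * qpow (1/8) τ * Complex.sin ((Real.pi : ℂ) * v) *
    ∏' j : ℕ, ((1 - qpow ((j : ℂ) + 1) τ)
      * (1 - Complex.exp (2 * (Real.pi : ℂ) * Complex.I * v) * qpow ((j : ℂ) + 1) τ)
      * (1 - Complex.exp (-(2 * (Real.pi : ℂ) * Complex.I * v)) * qpow ((j : ℂ) + 1) τ))

/-- The Jacobi theta function `θ₁(v, τ)`, defined by its infinite product. -/
def jTheta1 (v τ : ℂ) : ℂ :=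
  2 * qpow (1/8) τ * Complex.cos ((Real.pi : ℂ) * v) *
    ∏' j : ℕ, ((1 - qpow ((j : ℂ) + 1) τ)
      * (1 + Complex.exp (2 * (Real.pi : ℂ) * Complex.I * v) * qpow ((j : ℂ) + 1) τ)
      * (1 + Complex.exp (-(2 * (Real.pi : ℂ) * Complex.I * v)) * qpow ((j : ℂ) + 1) τ))

/-- The Jacobi theta function `θ₂(v, τ)`, defined by its infinite product
(the `j`-th factor involves `q^{j+1-1/2}`). -/
def jTheta2 (v τ : ℂ) : ℂ :=
  ∏' j : ℕ, ((1 - qpow ((j : ℂ) + 1) τ)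
    * (1 - Complex.exp (2 * (Real.pi : ℂ) * Complex.I * v) * qpow ((j : ℂ) + 1/2) τ)
    * (1 - Complex.exp (-(2 * (Real.pi : ℂ) * Complex.I * v)) * qpow ((j : ℂ) + 1/2) τ))

/-- The Jacobi theta function `θ₃(v, τ)`, defined by its infinite product. -/
def jTheta3 (v τ : ℂ) : ℂ :=
  ∏' j : ℕ, ((1 - qpow ((j : ℂ) + 1) τ)
    * (1 + Complex.exp (2 * (Real.pi : ℂ) * Complex.I * v) * qpow ((j : ℂ) + 1/2) τ)
    * (1 + Complex.exp (-(2 * (Real.pi : ℂ) * Complex.I * v)) * qpow ((j : ℂ) + 1/2) τ))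

/-- `θ'(0, τ)`: the partial derivative of `θ(v, τ)` in `v`, evaluated at `v = 0`. -/
def jThetaDeriv (τ : ℂ) : ℂ := deriv (fun v => jTheta v τ) 0

/-- `ε₁(τ) = (1/16)θ₂(0,τ)⁴θ₃(0,τ)⁴`. -/
def epsilon1 (τ : ℂ) : ℂ := (1/16) * (jTheta2 0 τ ^ 4 * jTheta3 0 τ ^ 4)

open ModularForm (eta_q)
open Function.Periodic (qParam)
open scoped MatrixGroups ModularForm

/-- The eighth power of the Dedekind eta function. -/
def etaPowEight (τ : ℂ) : ℂ := ModularForm.eta τ ^ 8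

lemma etaPowEight_ne_zero {τ : ℂ} (hτ : 0 < τ.im) : etaPowEight τ ≠ 0 :=
  pow_ne_zero _ (ModularForm.eta_ne_zero hτ)

section Product

lemma qpow_add_one_eq_eta_q (j : ℕ) (τ : ℂ) : qpow ((j : ℂ) + 1) τ = eta_q j τ := by
  rw [qpow, ModularForm.eta_q_eq_cexp]

lemma qpow_add_half_sq (j : ℕ) (τ : ℂ) : qpow ((j : ℂ) + 1 / 2) τ ^ 2 = eta_q (2 * j) τ := by
  rw [qpow, ModularForm.eta_q_eq_cexp, ← Complex.exp_nat_mul]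
  congr 1
  push_cast
  ring

lemma eta_q_odd (j : ℕ) (τ : ℂ) : eta_q (2 * j + 1) τ = eta_q j (2 * τ) := by
  rw [ModularForm.eta_q_eq_cexp, ModularForm.eta_q_eq_cexp]
  congr 1
  push_cast
  ring

lemma summable_norm_eta_q {τ : ℂ} (hτ : 0 < τ.im) : Summable fun j ↦ ‖-eta_q j τ‖ :=
  ModularForm.summable_eta_q ⟨τ, hτ⟩

lemma summable_norm_qpow_add_half {τ : ℂ} (hτ : 0 < τ.im) :
    Summable fun j : ℕ ↦ ‖qpow ((j : ℂ) + 1 / 2) τ‖ := by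
  have h := ((ModularForm.summable_eta_q ⟨τ, hτ⟩)).mul_left ‖qpow (-1 / 2) τ‖
  refine h.congr fun j ↦ ?_
  rw [norm_neg, ← norm_mul, ← qpow_add_one_eq_eta_q, qpow, qpow, qpow, ← Complex.exp_add]
  congr 2
  ring

lemma multipliable_one_sub_eta_q {τ : ℂ} (hτ : 0 < τ.im) :
    Multipliable fun j ↦ 1 - eta_q j τ := by
  simpa only [sub_eq_add_neg] using multipliable_one_add_of_summable (summable_norm_eta_q hτ)

lemma multipliable_one_add_qpow {τ : ℂ} (hτ : 0 < τ.im) :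
    Multipliable fun j : ℕ ↦ 1 + qpow ((j : ℂ) + 1 / 2) τ :=
  multipliable_one_add_of_summable (summable_norm_qpow_add_half hτ)

lemma multipliable_one_sub_qpow {τ : ℂ} (hτ : 0 < τ.im) :
    Multipliable fun j : ℕ ↦ 1 - qpow ((j : ℂ) + 1 / 2) τ := by
  simpa only [sub_eq_add_neg] using multipliable_one_add_of_summable
    (f := fun j : ℕ ↦ -qpow ((j : ℂ) + 1 / 2) τ)
    (by simpa only [norm_neg] using summable_norm_qpow_add_half hτ)

lemma multipliable_one_sub_eta_q_even {τ : ℂ} (hτ : 0 < τ.im) :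
    Multipliable fun j ↦ 1 - eta_q (2 * j) τ := by
  refine ((multipliable_one_sub_qpow hτ).mul (multipliable_one_add_qpow hτ)).congr fun j ↦ ?_
  rw [← qpow_add_half_sq]
  ring

lemma jTheta2_zero_mul_jTheta3_zero {τ : ℂ} (hτ : 0 < τ.im) :
    jTheta2 0 τ * jTheta3 0 τ =
      (∏' j, (1 - eta_q j τ)) ^ 2 * (∏' j, (1 - eta_q (2 * j) τ)) ^ 2 := by
  have hE := multipliable_one_sub_eta_q hτ
  have hO := multipliable_one_sub_eta_q_even hτ
  have h2 := (hE.mul (multipliable_one_sub_qpow hτ)).mul (multipliable_one_sub_qpow hτ)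
  have h3 := (hE.mul (multipliable_one_add_qpow hτ)).mul (multipliable_one_add_qpow hτ)
  simp only [jTheta2, jTheta3, mul_zero, neg_zero, Complex.exp_zero, one_mul,
    qpow_add_one_eq_eta_q]
  rw [← h2.tprod_mul h3, ← hE.tprod_pow, ← hO.tprod_pow, ← (hE.pow 2).tprod_mul (hO.pow 2)]
  refine tprod_congr fun j ↦ ?_
  rw [← qpow_add_half_sq]
  ring

lemma tprod_one_sub_eta_q_even_mul {τ : ℂ} (hτ : 0 < τ.im) :
    (∏' j, (1 - eta_q (2 * j) τ)) * ∏' j, (1 - eta_q j (2 * τ)) = ∏' j, (1 - eta_q j τ) := by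
  have h2 : 0 < (2 * τ).im := by simpa using hτ
  have h := tprod_even_mul_odd (f := fun j ↦ 1 - eta_q j τ) (multipliable_one_sub_eta_q_even hτ)
    ((multipliable_one_sub_eta_q h2).congr fun j ↦ by rw [eta_q_odd])
  simpa only [eta_q_odd] using h

lemma epsilon1_eq_eta {τ : ℂ} (hτ : 0 < τ.im) :
    epsilon1 τ = etaPowEight τ ^ 2 / (16 * etaPowEight (2 * τ)) := by
  have h2 : 0 < (2 * τ).im := by simpa using hτ
  have hne : (∏' j, (1 - eta_q j (2 * τ))) ≠ 0 := ModularForm.eta_tprod_ne_zero h2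
  have hq : qParam 24 (2 * τ) = qParam 24 τ ^ 2 := by
    rw [qParam, qParam, ← Complex.exp_nat_mul]
    congr 1
    push_cast
    ring
  have hq0 : qParam 24 τ ≠ 0 := Function.Periodic.qParam_ne_zero τ
  rw [epsilon1, ← mul_pow, jTheta2_zero_mul_jTheta3_zero hτ, etaPowEight, etaPowEight,
    ModularForm.eta, ModularForm.eta, hq, ← tprod_one_sub_eta_q_even_mul hτ]
  field_simp

end Product

lemma differentiableAt_etaPowEight {τ : ℂ} (hτ : 0 < τ.im) : DifferentiableAt ℂ etaPowEight τ :=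
  (ModularForm.differentiableAt_eta_of_mem_upperHalfPlaneSet hτ).pow 8

lemma differentiableOn_epsilon1 : DifferentiableOn ℂ epsilon1 {τ : ℂ | 0 < τ.im} := by
  refine DifferentiableOn.congr (f := fun τ ↦ etaPowEight τ ^ 2 / (16 * etaPowEight (2 * τ)))
    (fun τ (hτ : 0 < τ.im) ↦ ?_) fun τ hτ ↦ epsilon1_eq_eta hτ
  have h2 : 0 < (2 * τ).im := by simpa using hτ
  have hd : DifferentiableAt ℂ (fun τ ↦ etaPowEight (2 * τ)) τ :=
    (differentiableAt_etaPowEight h2).comp τ (differentiableAt_id.const_mul 2)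
  exact (((differentiableAt_etaPowEight hτ).pow 2).div (hd.const_mul 16)
    (mul_ne_zero (by norm_num) (etaPowEight_ne_zero h2))).differentiableWithinAt

section Multiplier

/-- The exponent of the multiplier system of `η ^ 8`, as a function of the entries of a matrix. -/
def etaExponent {R : Type*} [CommRing R] (a b c d : R) : R :=
  (a + d) * c - b * d * (c ^ 2 - 1)

/-- The multiplier system of `η ^ 8` on `SL₂(ℤ)`. -/
def etaMultiplier (a b c d : ℤ) : ℂ :=
  ZMod.stdAddChar (etaExponent (a : ZMod 3) (b : ZMod 3) (c : ZMod 3) (d : ZMod 3))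

lemma etaMultiplier_ne_zero (a b c d : ℤ) : etaMultiplier a b c d ≠ 0 := by
  rw [etaMultiplier, ← norm_ne_zero_iff, AddChar.norm_apply]
  exact one_ne_zero

lemma norm_etaMultiplier (a b c d : ℤ) : ‖etaMultiplier a b c d‖ = 1 :=
  AddChar.norm_apply _ _

lemma cast_det_eq_one {a b c d : ℤ} (h : a * d - b * c = 1) :
    (a * d - b * c : ZMod 3) = 1 := by
  exact_mod_cast congrArg (Int.cast : ℤ → ZMod 3) h

lemma etaMultiplier_S_mul {a b c d : ℤ} (h : a * d - b * c = 1) :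
    etaMultiplier (-c) (-d) a b = etaMultiplier a b c d := by
  have key : ∀ a b c d : ZMod 3, a * d - b * c = 1 →
      etaExponent (-c) (-d) a b = etaExponent a b c d := by
    unfold etaExponent; decide
  simp only [etaMultiplier, Int.cast_neg, key _ _ _ _ (cast_det_eq_one h)]

lemma etaMultiplier_T_mul {a b c d : ℤ} (h : a * d - b * c = 1) :
    etaMultiplier (a + c) (b + d) c d = ZMod.stdAddChar (1 : ZMod 3) * etaMultiplier a b c d := by
  have key : ∀ a b c d : ZMod 3, a * d - b * c = 1 →
      etaExponent (a + c) (b + d) c d = 1 + etaExponent a b c d := by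
    unfold etaExponent; decide
  simp only [etaMultiplier, Int.cast_add, key _ _ _ _ (cast_det_eq_one h), AddChar.map_add_eq_mul]

lemma etaMultiplier_sq_of_even {a b c d : ℤ} (h : a * d - b * (2 * c) = 1) :
    etaMultiplier a b (2 * c) d ^ 2 = etaMultiplier a (2 * b) c d := by
  have key : ∀ a b c d : ZMod 3, a * d - b * (2 * c) = 1 →
      2 • etaExponent a b (2 * c) d = etaExponent a (2 * b) c d := by
    unfold etaExponent; decide
  have h' := cast_det_eq_one h
  push_cast at h'
  simp only [etaMultiplier, Int.cast_mul, Int.cast_ofNat, ← AddChar.map_nsmul_eq_pow,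
    key _ _ _ _ h']

end Multiplier

section Transformation

lemma etaPowEight_add_one (τ : ℂ) :
    etaPowEight (τ + 1) = ZMod.stdAddChar (1 : ZMod 3) * etaPowEight τ := by
  have hω : (ZMod.stdAddChar (1 : ZMod 3) : ℂ) = Complex.exp (2 * Real.pi * Complex.I / 3) := by
    have := ZMod.stdAddChar_coe (N := 3) 1
    simpa using this
  have h24 : qParam 24 (τ + 1) ^ 8 =
      Complex.exp (2 * Real.pi * Complex.I / 3) * qParam 24 τ ^ 8 := by
    rw [qParam, qParam, ← Complex.exp_nat_mul, ← Complex.exp_nat_mul, ← Complex.exp_add]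
    congr 1
    push_cast
    ring
  have h1 : qParam 1 (τ + 1) = qParam 1 τ := by
    have h : Complex.exp (2 * Real.pi * Complex.I * (τ + 1)) =
        Complex.exp (2 * Real.pi * Complex.I * τ) := by
      rw [mul_add, mul_one, Complex.exp_periodic]
    simpa [qParam] using h
  rw [etaPowEight, etaPowEight, ModularForm.eta, ModularForm.eta, mul_pow, mul_pow, h24, hω]
  simp only [eta_q, h1, mul_assoc]

lemma etaPowEight_neg_one_div {τ : ℂ} (hτ : 0 < τ.im) :
    etaPowEight (-1 / τ) = τ ^ 4 * etaPowEight τ := by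
  have hsqrt : ∀ {z : ℂ}, z ≠ 0 → Complex.sqrt z ^ 8 = z ^ 4 := fun {z} hz ↦ by
    rw [show (8 : ℕ) = 2 * 4 from rfl, pow_mul]
    congr 1
    rw [Complex.sqrt, ← Complex.cpow_nat_mul]
    norm_num
  have hτ0 : τ ≠ 0 := by rintro rfl; simp at hτ
  have h := ModularForm.eta_comp_eq_csqrt_I_inv hτ
  simp only [Function.comp_apply, Pi.smul_apply, Pi.mul_apply, smul_eq_mul] at h
  rw [etaPowEight, h, mul_pow, mul_pow, inv_pow, hsqrt Complex.I_ne_zero, hsqrt hτ0,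
    Complex.I_pow_four, inv_one, one_mul, etaPowEight]

lemma etaPowEight_slash_S :
    (fun z : UpperHalfPlane ↦ etaPowEight z) ∣[(4 : ℤ)] ModularGroup.S =
      fun z : UpperHalfPlane ↦ etaPowEight z := by
  ext z
  have hz := UpperHalfPlane.ne_zero z
  rw [ModularForm.SL_slash_apply, ModularGroup.denom_S, UpperHalfPlane.modular_S_smul,
    UpperHalfPlane.coe_mk, show (-(z : ℂ))⁻¹ = -1 / z by field_simp, etaPowEight_neg_one_div z.2]
  rw [zpow_neg, mul_right_comm]
  norm_cast
  rw [mul_inv_cancel₀ (pow_ne_zero 4 hz), one_mul]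

lemma etaPowEight_slash_T :
    (fun z : UpperHalfPlane ↦ etaPowEight z) ∣[(4 : ℤ)] ModularGroup.T =
      (ZMod.stdAddChar (1 : ZMod 3) : ℂ) • fun z : UpperHalfPlane ↦ etaPowEight z := by
  ext z
  have hd : UpperHalfPlane.denom (ModularGroup.T : GL (Fin 2) ℝ) z = 1 := by
    rw [ModularGroup.denom_apply, ModularGroup.coe_T]
    simp
  rw [ModularForm.SL_slash_apply, hd, UpperHalfPlane.modular_T_smul, one_zpow, mul_one,
    UpperHalfPlane.coe_vadd, add_comm, Complex.ofReal_one, etaPowEight_add_one]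
  rfl

lemma det_entries (γ : SL(2, ℤ)) : γ 0 0 * γ 1 1 - γ 0 1 * γ 1 0 = 1 := by
  rw [← Matrix.det_fin_two]
  exact γ.det_coe

lemma etaMultiplier_S_mul_matrix (γ : SL(2, ℤ)) :
    etaMultiplier ((ModularGroup.S * γ) 0 0) ((ModularGroup.S * γ) 0 1)
      ((ModularGroup.S * γ) 1 0) ((ModularGroup.S * γ) 1 1) =
    etaMultiplier (γ 0 0) (γ 0 1) (γ 1 0) (γ 1 1) := by
  rw [← etaMultiplier_S_mul (det_entries γ)]
  simp [Matrix.SpecialLinearGroup.coe_mul, ModularGroup.coe_S, Matrix.mul_apply, Fin.sum_univ_two]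

lemma etaMultiplier_T_mul_matrix (γ : SL(2, ℤ)) :
    etaMultiplier ((ModularGroup.T * γ) 0 0) ((ModularGroup.T * γ) 0 1)
      ((ModularGroup.T * γ) 1 0) ((ModularGroup.T * γ) 1 1) =
    ZMod.stdAddChar (1 : ZMod 3) * etaMultiplier (γ 0 0) (γ 0 1) (γ 1 0) (γ 1 1) := by
  rw [← etaMultiplier_T_mul (det_entries γ)]
  simp [Matrix.SpecialLinearGroup.coe_mul, ModularGroup.coe_T, Matrix.mul_apply, Fin.sum_univ_two]

lemma etaPowEight_slash (γ : SL(2, ℤ)) :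
    (fun z : UpperHalfPlane ↦ etaPowEight z) ∣[(4 : ℤ)] γ =
      etaMultiplier (γ 0 0) (γ 0 1) (γ 1 0) (γ 1 1) •
        fun z : UpperHalfPlane ↦ etaPowEight z := by
  have hω : (ZMod.stdAddChar (1 : ZMod 3) : ℂ) ≠ 0 := by
    rw [← norm_ne_zero_iff, AddChar.norm_apply]
    exact one_ne_zero
  have hγ : γ ∈ Subgroup.closure {ModularGroup.S, ModularGroup.T} := by
    simp [SpecialLinearGroup.SL2Z_generators]
  induction hγ using Subgroup.closure_induction_left with
  | one =>
    rw [SlashAction.slash_one]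
    simp [etaMultiplier, etaExponent]
  | mul_left x hx y hy ih =>
    rcases hx with rfl | rfl
    · rw [SlashAction.slash_mul, etaPowEight_slash_S, ih, etaMultiplier_S_mul_matrix]
    · rw [SlashAction.slash_mul, etaPowEight_slash_T, ModularForm.SL_smul_slash, ih,
        etaMultiplier_T_mul_matrix, mul_smul]
  | inv_mul_cancel x hx y hy ih =>
    rcases hx with rfl | rfl
    · rw [← etaMultiplier_S_mul_matrix, mul_inv_cancel_left, ← ih]
      nth_rw 1 [← etaPowEight_slash_S]
      rw [← SlashAction.slash_mul, mul_inv_cancel_left]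
    · have h := etaMultiplier_T_mul_matrix (ModularGroup.T⁻¹ * y)
      rw [mul_inv_cancel_left] at h
      refine smul_right_injective _ hω ?_
      simp only
      rw [← mul_smul, ← h, ← ih, ← ModularForm.SL_smul_slash, ← etaPowEight_slash_T,
        ← SlashAction.slash_mul, mul_inv_cancel_left]

lemma etaPowEight_moebius {a b c d : ℤ} (h : a * d - b * c = 1) {τ : ℂ} (hτ : 0 < τ.im) :
    etaPowEight ((a * τ + b) / (c * τ + d)) =
      etaMultiplier a b c d * (c * τ + d) ^ 4 * etaPowEight τ := by
  let γ : SL(2, ℤ) := ⟨!![a, b; c, d], by rw [Matrix.det_fin_two_of, h]⟩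
  let z : UpperHalfPlane := ⟨τ, hτ⟩
  have hs := congrFun (etaPowEight_slash γ) z
  have hd := UpperHalfPlane.denom_ne_zero (γ : GL (Fin 2) ℝ) z
  have hd' : UpperHalfPlane.denom (γ : GL (Fin 2) ℝ) z = c * τ + d := by
    rw [ModularGroup.denom_apply]
    simp [γ, z]
  rw [hd'] at hd
  rw [ModularForm.SL_slash_apply, hd', UpperHalfPlane.coe_specialLinearGroup_apply] at hs
  simp only [γ, z, Matrix.of_apply, Matrix.cons_val', Matrix.cons_val_zero,
    Matrix.cons_val_one, Matrix.cons_val_fin_one, algebraMap_int_eq, eq_intCast,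
    Complex.ofReal_intCast, Pi.smul_apply, smul_eq_mul, zpow_neg] at hs
  rw [← div_eq_mul_inv, div_eq_iff (zpow_ne_zero _ hd)] at hs
  rw [hs]
  norm_cast
  ring

lemma moebius_denom_ne_zero {a b c d : ℤ} (h : a * d - b * c = 1) {τ : ℂ} (hτ : 0 < τ.im) :
    (c * τ + d : ℂ) ≠ 0 := by
  intro h0
  have him := congrArg Complex.im h0
  have hre := congrArg Complex.re h0
  simp at him hre
  rcases him with rfl | him
  · simp at hre
    subst hre
    simp at h
  · exact hτ.ne' him

lemma moebius_im_pos {a b c d : ℤ} (h : a * d - b * c = 1) {τ : ℂ} (hτ : 0 < τ.im) :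
    0 < ((a * τ + b) / (c * τ + d) : ℂ).im := by
  let γ : SL(2, ℤ) := ⟨!![a, b; c, d], by rw [Matrix.det_fin_two_of, h]⟩
  have hz := (γ • (⟨τ, hτ⟩ : UpperHalfPlane)).im_pos
  rw [← UpperHalfPlane.coe_im, UpperHalfPlane.coe_specialLinearGroup_apply] at hz
  simpa [γ] using hz

/-- For even lower left entry, doubling the image of `τ` is a modular transformation of `2τ`. -/
lemma etaPowEight_two_mul_moebius_even {a b c d : ℤ} (h : a * d - b * (2 * c) = 1) {τ : ℂ}
    (hτ : 0 < τ.im) :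
    etaPowEight (2 * ((a * τ + b) / ((2 * c : ℤ) * τ + d))) =
      etaMultiplier a (2 * b) c d * ((2 * c : ℤ) * τ + d) ^ 4 * etaPowEight (2 * τ) := by
  have h2 : 0 < (2 * τ).im := by simpa using hτ
  have key := etaPowEight_moebius (a := a) (b := 2 * b) (c := c) (d := d) (by linarith) h2
  push_cast at key ⊢
  rw [show (2 * c * τ + d : ℂ) = c * (2 * τ) + d by ring, ← key]
  congr 1
  ring

/-- For odd lower left entry, doubling the image of `τ` is a modular transformation of
`(τ + k) / 2`, where `k` is an integer such that `c * k ≡ d` modulo `2`. -/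
lemma etaPowEight_two_mul_moebius_odd {a b c d k e : ℤ} (h : a * d - b * c = 1)
    (hk : d = c * k + 2 * e) {τ : ℂ} (hτ : 0 < τ.im) :
    etaPowEight (2 * ((a * τ + b) / (c * τ + d))) =
      etaMultiplier (2 * a) (b - a * k) c e * ((c * τ + d) / 2) ^ 4 *
        etaPowEight ((τ + k) / 2) := by
  have h2 : 0 < ((τ + k) / 2).im := by simpa using hτ
  have key := etaPowEight_moebius (a := 2 * a) (b := b - a * k) (c := c) (d := e)
    (by subst hk; linarith) h2
  have hd : (c * ((τ + k) / 2) + e : ℂ) = (c * τ + d) / 2 := by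
    rw [hk]; push_cast; ring
  rw [hd] at key
  rw [← key]
  congr 1
  push_cast
  field_simp
  ring

lemma epsilon1_moebius_even {a b c d : ℤ} (h : a * d - b * (2 * c) = 1) {τ : ℂ}
    (hτ : 0 < τ.im) :
    epsilon1 ((a * τ + b) / ((2 * c : ℤ) * τ + d)) = ((2 * c : ℤ) * τ + d) ^ 4 * epsilon1 τ := by
  have h2 : 0 < (2 * τ).im := by simpa using hτ
  have hφ := etaPowEight_ne_zero h2
  have hd := moebius_denom_ne_zero h hτ
  have hm := etaMultiplier_ne_zero a (2 * b) c d
  rw [epsilon1_eq_eta (moebius_im_pos h hτ), epsilon1_eq_eta hτ,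
    etaPowEight_two_mul_moebius_even h hτ, etaPowEight_moebius h hτ, mul_pow, mul_pow,
    etaMultiplier_sq_of_even h]
  field_simp

lemma epsilon1_moebius_odd {a b c d k e : ℤ} (h : a * d - b * c = 1)
    (hk : d = c * k + 2 * e) {τ : ℂ} (hτ : 0 < τ.im) :
    ‖((c * τ + d : ℂ) ^ 4)⁻¹ * epsilon1 ((a * τ + b) / (c * τ + d))‖ =
      ‖etaPowEight τ‖ ^ 2 / ‖etaPowEight ((τ + k) / 2)‖ := by
  have h2 : 0 < ((τ + k) / 2).im := by simpa using hτ
  have hφ := norm_ne_zero_iff.mpr (etaPowEight_ne_zero h2)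
  have hd := norm_ne_zero_iff.mpr (moebius_denom_ne_zero h hτ)
  rw [epsilon1_eq_eta (moebius_im_pos h hτ), etaPowEight_two_mul_moebius_odd h hk hτ,
    etaPowEight_moebius h hτ]
  simp only [norm_mul, norm_inv, norm_pow, norm_div, norm_etaMultiplier, Complex.norm_ofNat]
  field_simp
  norm_num

end Transformation

section Growth

lemma exists_norm_etaPowEight_bounds : ∃ A : ℝ, 0 < A ∧ ∀ τ : ℂ, A ≤ τ.im →
    Real.exp (-2 * Real.pi * τ.im) / 2 ≤ ‖etaPowEight τ‖ ^ 3 ∧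
      ‖etaPowEight τ‖ ^ 3 ≤ 2 * Real.exp (-2 * Real.pi * τ.im) := by
  have hlim := ModularForm.tendsto_atImInfty_tprod_one_sub_eta_q_pow.norm
  rw [norm_one] at hlim
  have hev := hlim.eventually (Icc_mem_nhds (by norm_num : (1 / 2 : ℝ) < 1) one_lt_two)
  obtain ⟨A, hA⟩ := (UpperHalfPlane.atImInfty_mem _).mp hev
  refine ⟨max A 1, by positivity, fun τ hτ ↦ ?_⟩
  have hpos : 0 < τ.im := zero_lt_one.trans_le ((le_max_right A 1).trans hτ)
  obtain ⟨hl, hu⟩ := hA ⟨τ, hpos⟩ ((le_max_left A 1).trans hτ)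
  have hΔ := ModularForm.discriminant_eq_q_prod ⟨τ, hpos⟩
  have hq : ‖qParam 1 τ‖ = Real.exp (-2 * Real.pi * τ.im) := by
    rw [Function.Periodic.norm_qParam, div_one]
  have hnorm : ‖etaPowEight τ‖ ^ 3 =
      Real.exp (-2 * Real.pi * τ.im) * ‖∏' n, (1 - eta_q n τ) ^ 24‖ := by
    rw [← hq, ← norm_mul, ← norm_pow, etaPowEight, ← pow_mul]
    exact congrArg norm hΔ
  rw [hnorm]
  have he := Real.exp_pos (-2 * Real.pi * τ.im)
  constructor <;> nlinarith

lemma exists_bound_of_norm_eq_quotient {f : ℂ → ℂ} {g : ℂ → ℂ} {r s : ℝ} (hr : 0 < r) (hr2 : r ≤ 2)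
    (hg : ∀ τ, (g τ).im = r * τ.im) (hs : 0 ≤ s)
    (hf : ∀ τ : ℂ, 0 < τ.im → ‖f τ‖ = s * (‖etaPowEight τ‖ ^ 2 / ‖etaPowEight (g τ)‖)) :
    ∃ C A : ℝ, ∀ τ : ℂ, A ≤ τ.im → ‖f τ‖ ≤ C := by
  obtain ⟨A, hA, hbound⟩ := exists_norm_etaPowEight_bounds
  refine ⟨s * 9, max A (A / r), fun τ hτ ↦ ?_⟩
  have hτA := (le_max_left _ _).trans hτ
  have hpos : 0 < τ.im := hA.trans_le hτA
  have hgA : A ≤ (g τ).im := by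
    rw [hg, mul_comm, ← div_le_iff₀ hr]
    exact (le_max_right _ _).trans hτ
  rw [hf τ hpos]
  refine mul_le_mul_of_nonneg_left ?_ hs
  have hφ : 0 < ‖etaPowEight (g τ)‖ := norm_pos_iff.mpr (etaPowEight_ne_zero (hA.trans_le hgA))
  refine le_of_pow_le_pow_left₀ three_ne_zero (by norm_num) ?_
  rw [div_pow, div_le_iff₀ (by positivity), pow_right_comm]
  have hu := (hbound τ hτA).2
  have hl := (hbound (g τ) hgA).1
  have hexp : Real.exp (-2 * Real.pi * τ.im) ^ 2 ≤ Real.exp (-2 * Real.pi * (g τ).im) := by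
    rw [← Real.exp_nat_mul, Real.exp_le_exp, hg]
    have := mul_le_mul_of_nonneg_right hr2 (mul_pos Real.pi_pos hpos).le
    push_cast
    linarith
  calc (‖etaPowEight τ‖ ^ 3) ^ 2 ≤ (2 * Real.exp (-2 * Real.pi * τ.im)) ^ 2 := by gcongr
    _ = 4 * Real.exp (-2 * Real.pi * τ.im) ^ 2 := by ring
    _ ≤ 9 ^ 3 * (Real.exp (-2 * Real.pi * (g τ).im) / 2) := by
      linarith [Real.exp_pos (-2 * Real.pi * (g τ).im)]
    _ ≤ _ := by gcongr

end Growth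

/-- `ε₁` is a modular form of weight 4 over `Γ₀(2)` with trivial character:
it is holomorphic on the upper half-plane, transforms with weight 4 under `Γ₀(2)`,
and all its weight-4 slash translates are bounded as `Im τ → ∞`. -/
theorem epsilon1_modularForm_weight_four_Gamma0_two :
    DifferentiableOn ℂ epsilon1 {τ : ℂ | 0 < τ.im} ∧
    (∀ γ : Matrix.SpecialLinearGroup (Fin 2) ℤ, γ ∈ CongruenceSubgroup.Gamma0 2 →
      ∀ τ : ℂ, 0 < τ.im →
        epsilon1 (((γ 0 0 : ℂ) * τ + (γ 0 1 : ℂ)) / ((γ 1 0 : ℂ) * τ + (γ 1 1 : ℂ))) =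
          ((γ 1 0 : ℂ) * τ + (γ 1 1 : ℂ)) ^ 4 * epsilon1 τ) ∧
    (∀ γ : Matrix.SpecialLinearGroup (Fin 2) ℤ, ∃ C A : ℝ, ∀ τ : ℂ, A ≤ τ.im →
      ‖(((γ 1 0 : ℂ) * τ + (γ 1 1 : ℂ)) ^ 4)⁻¹ *
        epsilon1 (((γ 0 0 : ℂ) * τ + (γ 0 1 : ℂ)) / ((γ 1 0 : ℂ) * τ + (γ 1 1 : ℂ)))‖ ≤ C) := by
  refine ⟨differentiableOn_epsilon1, fun γ hγ τ hτ ↦ ?_, fun γ ↦ ?_⟩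
  · obtain ⟨c, hc⟩ := (ZMod.intCast_zmod_eq_zero_iff_dvd _ 2).mp
      (CongruenceSubgroup.Gamma0_mem.mp hγ)
    have h := det_entries γ
    rw [show γ 1 0 = 2 * c from hc] at h ⊢
    exact epsilon1_moebius_even h hτ
  · have h := det_entries γ
    rcases Int.even_or_odd' (γ 1 0) with ⟨c, hc | hc⟩
    · refine exists_bound_of_norm_eq_quotient (g := fun τ ↦ 2 * τ) (r := 2) (s := 1 / 16) two_pos
        le_rfl (by simp) (by norm_num) fun τ hτ ↦ ?_
      rw [hc] at h ⊢
      have hd := moebius_denom_ne_zero h hτ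
      rw [epsilon1_moebius_even h hτ, inv_mul_cancel_left₀ (pow_ne_zero 4 hd), epsilon1_eq_eta hτ]
      simp only [norm_div, norm_pow, norm_mul, Complex.norm_ofNat]
      ring
    · refine exists_bound_of_norm_eq_quotient (g := fun τ ↦ (τ + γ 1 1) / 2) (r := 1 / 2) (s := 1)
        (by norm_num) (by norm_num) (fun τ ↦ ?_) zero_le_one fun τ hτ ↦ ?_
      · simp
        ring
      · rw [one_mul]
        exact epsilon1_moebius_odd (e := -(c * γ 1 1)) h (by rw [hc]; ring) hτ
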